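/- Let ℓ ∈ ℕ and let n be an integer with n ≥ ℓ + 1. Then there exists a real polynomial p of degree exactly n - ℓ - 1 with p(0) ≠ 0 such that r p''(r) + (2(ℓ+1) - (2/n) r) p'(r) + (2/n)(n - ℓ - 1) p(r) = 0 for all r ∈ ℝ. -/

import Mathlib

open Polynomial in
/-- A Laguerre-type operator with parameters `a > 0` and `c ≠ 0` has a polynomial null vector of
every degree `k`, and it does not vanish at `0`. -/
theorem exists_polynomial_laguerre_equation {a c : ℝ} (ha : 0 < a) (hc : c ≠ 0) (k : ℕ) :
    ∃ p : ℝ[X], p.natDegree = k ∧ p.coeff 0 ≠ 0 ∧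
      X * derivative (derivative p) + (C a - C c * X) * derivative p + C (c * k) * p = 0 := by
  let b : ℕ → ℝ := fun j => ∏ i ∈ Finset.range j, c * ((i : ℝ) - k) / ((i + 1) * (i + a))
  have hb_succ (j : ℕ) : b (j + 1) * ((j + 1) * (j + a)) = c * (j - k) * b j := by
    have : (j : ℝ) + 1 ≠ 0 := by positivity
    have : (j : ℝ) + a ≠ 0 := by positivity
    simp only [b, Finset.prod_range_succ]
    field_simp
  have hb_zero (j : ℕ) (hj : k < j) : b j = 0 :=
    Finset.prod_eq_zero (Finset.mem_range.2 hj) (by simp)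
  have hb_ne : b k ≠ 0 := Finset.prod_ne_zero_iff.2 fun i hi => by
    have : (i : ℝ) < k := by exact_mod_cast Finset.mem_range.1 hi
    have : (i : ℝ) - k ≠ 0 := by linarith
    positivity
  let p : ℝ[X] := ∑ j ∈ Finset.range (k + 1), monomial j (b j)
  have hp (j : ℕ) : p.coeff j = b j := by
    simp only [p, finsetSum_coeff, coeff_monomial, Finset.sum_ite_eq', Finset.mem_range]
    split_ifs with h
    · rfl
    · exact (hb_zero j (by omega)).symm
  refine ⟨p, natDegree_eq_of_le_of_coeff_ne_zero ?_ (by rwa [hp]), by simp [hp, b], ?_⟩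
  · exact natDegree_le_iff_coeff_eq_zero.2 fun j hj => by rw [hp, hb_zero j hj]
  · ext j
    have h := hb_succ j
    cases j with
    | zero =>
      simp [sub_mul, mul_assoc, coeff_derivative, hp] at h ⊢
      linarith
    | succ j =>
      simp only [coeff_add, coeff_sub, sub_mul, mul_assoc, coeff_C_mul, coeff_X_mul,
        coeff_derivative, hp, coeff_zero]
      push_cast at h ⊢
      linear_combination h


/-- For every `ℓ ∈ ℕ` and integer `n ≥ ℓ+1` there is a real polynomial of degree exactly
`n-ℓ-1`, nonvanishing at `0`, solving the Laguerre-type equation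
`r p'' + (2(ℓ+1) - (2/n) r) p' + (2/n)(n-ℓ-1) p = 0`. -/
theorem stmt_15 (ℓ : ℕ) (n : ℕ) (hn : ℓ + 1 ≤ n) :
    ∃ p : Polynomial ℝ, p.natDegree = n - ℓ - 1 ∧ p.eval 0 ≠ 0 ∧
      ∀ r : ℝ,
        r * p.derivative.derivative.eval r
          + (2 * ((ℓ : ℝ) + 1) - (2 / (n : ℝ)) * r) * p.derivative.eval r
          + (2 / (n : ℝ)) * ((n : ℝ) - (ℓ : ℝ) - 1) * p.eval r = 0 := by
  have hn_pos : (0 : ℝ) < n := by exact_mod_cast (by omega : 0 < n)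
  obtain ⟨p, hdeg, h0, hp⟩ := exists_polynomial_laguerre_equation
    (a := 2 * ((ℓ : ℝ) + 1)) (c := 2 / (n : ℝ)) (by positivity) (by positivity) (n - ℓ - 1)
  refine ⟨p, hdeg, by rwa [← Polynomial.coeff_zero_eq_eval_zero], fun r => ?_⟩
  have h := congrArg (Polynomial.eval r) hp
  have hk : ((n - ℓ - 1 : ℕ) : ℝ) = n - ℓ - 1 := by
    rw [Nat.sub_sub, Nat.cast_sub hn]
    push_cast
    ring
  simpa only [Polynomial.eval_add, Polynomial.eval_sub, Polynomial.eval_mul, Polynomial.eval_X,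
    Polynomial.eval_C, Polynomial.eval_zero, hk] using h
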